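/- arXiv:1903.11803 — 2 statements merged into one kernel-verified Lean document; each statement's English description precedes it below -/
import Mathlib

section
/- For every K > 1, the function ψ(r) = 4Kr/((K+1)(1-r)) + 2(K-1)·log(1-r)/(K+1) − 1 is strictly increasing on (0,1) and has exactly one zero r₀ in (0,1); moreover r₀ < 1/3, and for r ∈ (0,1) one has ψ(r) ≤ 0 if and only if r ≤ r₀. -/
/-- The function `ψ(r) = 4Kr/((K+1)(1-r)) + 2(K-1)log(1-r)/(K+1) - 1`. -/
noncomputable def psi (K r : ℝ) : ℝ :=
  4 * K * r / ((K + 1) * (1 - r)) + 2 * (K - 1) * Real.log (1 - r) / (K + 1) - 1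

theorem psi_strictMonoOn {K : ℝ} (hK : 1 < K) : StrictMonoOn (psi K) (Set.Ico 0 1) := by
  rintro a ⟨ha, ha'⟩ b ⟨-, hb⟩ hab
  have hu : 0 < 1 - a := by linarith
  have hv : 0 < 1 - b := by linarith
  have hlog : Real.log (1 - a) - Real.log (1 - b) ≤ (b - a) / (1 - b) := by
    rw [← Real.log_div hu.ne' hv.ne']
    refine (Real.log_le_sub_one_of_pos (div_pos hu hv)).trans_eq ?_
    field_simp
    ring
  have hquot : (b - a) / (1 - b) ≤ b / (1 - b) - a / (1 - a) := by
    have h : b / (1 - b) - a / (1 - a) - (b - a) / (1 - b)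
        = a * (b - a) / ((1 - b) * (1 - a)) := by
      field_simp
      ring
    have : 0 ≤ a * (b - a) / ((1 - b) * (1 - a)) :=
      div_nonneg (mul_nonneg ha (by linarith)) (mul_pos hv hu).le
    linarith
  have hpos : 0 < (b - a) / (1 - b) := div_pos (by linarith) hv
  have hdiff : psi K b - psi K a = (4 * K * (b / (1 - b) - a / (1 - a))
      - 2 * (K - 1) * (Real.log (1 - a) - Real.log (1 - b))) / (K + 1) := by
    unfold psi
    have : K + 1 ≠ 0 := by linarith
    field_simp
    ring
  rw [← sub_pos, hdiff]
  refine div_pos ?_ (by linarith)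
  have h₁ := mul_le_mul_of_nonneg_left hquot (by linarith : 0 ≤ 4 * K)
  have h₂ := mul_le_mul_of_nonneg_left hlog (by linarith : 0 ≤ 2 * (K - 1))
  have h₃ := mul_pos (by linarith : 0 < 2 * K + 2) hpos
  linarith

theorem psi_zero (K : ℝ) : psi K 0 = -1 := by
  simp [psi]

theorem psi_one_third_pos {K : ℝ} (hK : 1 < K) : 0 < psi K (1 / 3) := by
  have hlog : Real.log (3 / 2) < 3 / 2 - 1 :=
    Real.log_lt_sub_one_of_pos (by norm_num) (by norm_num)
  have hinv : Real.log (1 - 1 / 3) = -Real.log (3 / 2) := by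
    rw [← Real.log_inv]
    norm_num
  have h : psi K (1 / 3) = (K - 1) * (1 - 2 * Real.log (3 / 2)) / (K + 1) := by
    rw [psi, hinv]
    have : K + 1 ≠ 0 := by linarith
    field_simp
    ring
  rw [h]
  exact div_pos (mul_pos (by linarith) (by linarith)) (by linarith)

theorem psi_continuousOn {K : ℝ} (hK : 1 < K) : ContinuousOn (psi K) (Set.Ico 0 1) := by
  intro r hr
  have h₁ : 1 - r ≠ 0 := by linarith [hr.2]
  have h₂ : (K + 1) * (1 - r) ≠ 0 := mul_ne_zero (by linarith) h₁
  unfold psi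
  exact ContinuousAt.continuousWithinAt (by fun_prop (disch := assumption))

/-- For `K > 1`, the function `ψ(r) = 4Kr/((K+1)(1-r)) + 2(K-1)log(1-r)/(K+1) - 1`
is strictly increasing on `(0,1)`, has a unique zero `r₀` there, `r₀ < 1/3`, and
for `r ∈ (0,1)` one has `ψ(r) ≤ 0 ↔ r ≤ r₀`. -/
theorem stmt_7 (K : ℝ) (hK : 1 < K) :
    StrictMonoOn
      (fun r : ℝ => 4 * K * r / ((K + 1) * (1 - r))
        + 2 * (K - 1) * Real.log (1 - r) / (K + 1) - 1) (Set.Ioo 0 1) ∧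
    ∃ r₀ ∈ Set.Ioo (0 : ℝ) 1,
      (4 * K * r₀ / ((K + 1) * (1 - r₀))
        + 2 * (K - 1) * Real.log (1 - r₀) / (K + 1) - 1 = 0) ∧
      (∀ r ∈ Set.Ioo (0 : ℝ) 1,
        4 * K * r / ((K + 1) * (1 - r))
          + 2 * (K - 1) * Real.log (1 - r) / (K + 1) - 1 = 0 → r = r₀) ∧
      r₀ < 1 / 3 ∧
      (∀ r ∈ Set.Ioo (0 : ℝ) 1,
        (4 * K * r / ((K + 1) * (1 - r))
          + 2 * (K - 1) * Real.log (1 - r) / (K + 1) - 1 ≤ 0 ↔ r ≤ r₀)) := by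
  have hmono := psi_strictMonoOn hK
  have hsub : Set.Ioo (0 : ℝ) 1 ⊆ Set.Ico 0 1 := Set.Ioo_subset_Ico_self
  obtain ⟨r₀, hr₀, hzero⟩ : (0 : ℝ) ∈ psi K '' Set.Ioo 0 (1 / 3) :=
    intermediate_value_Ioo (by norm_num)
      ((psi_continuousOn hK).mono (Set.Icc_subset_Ico_right (by norm_num)))
      ⟨by rw [psi_zero]; norm_num, psi_one_third_pos hK⟩
  have hmem : r₀ ∈ Set.Ioo (0 : ℝ) 1 := ⟨hr₀.1, hr₀.2.trans (by norm_num)⟩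
  refine ⟨hmono.mono hsub, r₀, hmem, hzero, fun r hr h => ?_, hr₀.2, fun r hr => ?_⟩
  · exact hmono.injOn (hsub hr) (hsub hmem) (Eq.trans h hzero.symm)
  · rw [← hmono.le_iff_le (hsub hr) (hsub hmem), hzero, psi]
end

section
/- For every real r with 0 ≤ r < 1/4, Σ_{n≥1} (1/n)·binom(2n,n)·r^n = 2·log(2/(1 + √(1 − 4r))). -/
theorem Ring.succ_mul_multichoose_succ {R : Type*} [Field R] [BinomialRing R] [CharZero R]
    (a : R) (n : ℕ) :
    (n + 1) * Ring.multichoose a (n + 1) = (a + n) * Ring.multichoose a n := by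
  have h := Ring.factorial_nsmul_multichoose_eq_ascPochhammer a n
  have h' := Ring.factorial_nsmul_multichoose_eq_ascPochhammer a (n + 1)
  rw [Polynomial.ascPochhammer_smeval_eq_eval, nsmul_eq_mul] at h h'
  rw [ascPochhammer_succ_eval, ← h, Nat.factorial_succ] at h'
  have hn : (n.factorial : R) ≠ 0 := by exact_mod_cast n.factorial_ne_zero
  apply mul_left_cancel₀ hn
  push_cast at h'
  linear_combination h'

theorem four_pow_mul_multichoose_half (n : ℕ) :
    4 ^ n * Ring.multichoose (1 / 2 : ℝ) n = n.centralBinom := by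
  induction n with
  | zero => simp
  | succ n ih =>
    have h := Ring.succ_mul_multichoose_succ (1 / 2 : ℝ) n
    have hc : ((n : ℝ) + 1) * (n + 1).centralBinom = 2 * (2 * n + 1) * n.centralBinom := by
      exact_mod_cast n.succ_mul_centralBinom_succ
    have hn : (n : ℝ) + 1 ≠ 0 := by positivity
    apply mul_left_cancel₀ hn
    rw [hc, ← ih]
    linear_combination 4 ^ (n + 1) * h

theorem hasSum_centralBinom_mul_pow {x : ℝ} (hx : |x| < 1 / 4) :
    HasSum (fun n : ℕ => (n.centralBinom : ℝ) * x ^ n) (1 / √(1 - 4 * x)) := by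
  have hball : 4 * x ∈ Metric.eball (0 : ℝ) 1 := by
    rw [mem_eball_zero_iff, ← ofReal_norm, ENNReal.ofReal_lt_one, Real.norm_eq_abs, abs_mul,
      abs_of_pos four_pos]
    linarith
  have h := (Real.one_div_one_sub_rpow_hasFPowerSeriesOnBall_zero (1 / 2)).hasSum hball
  rw [zero_add, ← Real.sqrt_eq_rpow] at h
  refine h.congr_fun fun n => ?_
  rw [FormalMultilinearSeries.ofScalars_apply_eq, ← Ring.multichoose_eq, smul_eq_mul,
    ← four_pow_mul_multichoose_half]
  ring

theorem hasSum_centralBinom_succ_mul_pow {x : ℝ} (hx : |x| < 1 / 4) :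
    HasSum (fun n : ℕ => ((n + 1).centralBinom : ℝ) * x ^ n)
      (4 / (√(1 - 4 * x) * (1 + √(1 - 4 * x)))) := by
  have hpos : 0 < 1 - 4 * x := by linarith [(abs_lt.mp hx).2]
  have hs : 0 < √(1 - 4 * x) := Real.sqrt_pos.2 hpos
  have hsq := Real.sq_sqrt hpos.le
  rcases eq_or_ne x 0 with rfl | hx0
  · convert hasSum_single (f := fun n : ℕ => ((n + 1).centralBinom : ℝ) * 0 ^ n) 0 ?_ using 1
    · norm_num [Nat.centralBinom]
    · intro n hn
      simp [hn]
  · have h := ((hasSum_nat_add_iff' 1).2 (hasSum_centralBinom_mul_pow hx)).mul_left x⁻¹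
    convert! h using 1
    · funext n
      field_simp
      ring
    · simp only [Finset.range_one, Finset.sum_singleton, Nat.centralBinom_zero, pow_zero]
      generalize √(1 - 4 * x) = s at *
      have hs1 : 0 < 1 + s := by linarith
      field_simp
      push_cast
      linear_combination hsq

theorem hasDerivAt_two_mul_log_two_div_one_add_sqrt {x : ℝ} (hx : x < 1 / 4) :
    HasDerivAt (fun y => 2 * Real.log (2 / (1 + √(1 - 4 * y))))
      (4 / (√(1 - 4 * x) * (1 + √(1 - 4 * x)))) x := by
  have hpos : 0 < 1 - 4 * x := by linarith
  have hs : 0 < √(1 - 4 * x) := Real.sqrt_pos.2 hpos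
  have hs1 : 0 < 1 + √(1 - 4 * x) := by linarith
  have h := (((((((hasDerivAt_id x).const_mul 4).const_sub 1).sqrt hpos.ne').const_add 1).fun_inv
    hs1.ne').const_mul 2).log (by positivity) |>.const_mul 2
  convert! h using 1
  have hid : id x = x := rfl
  rw [hid]
  field_simp

theorem hasSum_centralBinom_succ_div_mul_pow {r : ℝ} (hr : |r| < 1 / 4) :
    HasSum (fun n : ℕ => 1 / ((n : ℝ) + 1) * ((n + 1).centralBinom : ℝ) * r ^ (n + 1))
      (2 * Real.log (2 / (1 + √(1 - 4 * r)))) := by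
  obtain ⟨ρ, hrρ, hρ⟩ := exists_between hr
  have hρ0 : 0 < ρ := (abs_nonneg r).trans_lt hrρ
  set g : ℕ → ℝ → ℝ := fun n y => 1 / ((n : ℝ) + 1) * ((n + 1).centralBinom : ℝ) * y ^ (n + 1)
  have hu := (hasSum_centralBinom_succ_mul_pow (x := ρ) (by rwa [abs_of_pos hρ0])).summable
  have hg : ∀ n, ∀ y ∈ Set.Ioo (-ρ) ρ,
      HasDerivAt (g n) (((n + 1).centralBinom : ℝ) * y ^ n) y := by
    intro n y _
    convert! (hasDerivAt_pow (n + 1) y).const_mul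
      (1 / ((n : ℝ) + 1) * ((n + 1).centralBinom : ℝ)) using 1
    push_cast
    field_simp
  have hg' : ∀ n, ∀ y ∈ Set.Ioo (-ρ) ρ,
      ‖((n + 1).centralBinom : ℝ) * y ^ n‖ ≤ ((n + 1).centralBinom : ℝ) * ρ ^ n := by
    intro n y hy
    rw [norm_mul, norm_pow, Real.norm_natCast, Real.norm_eq_abs]
    gcongr
    exact (abs_lt.2 hy).le
  have h0 : (0 : ℝ) ∈ Set.Ioo (-ρ) ρ := by simp [hρ0]
  have hg0 : Summable fun n => g n 0 := by simp [g]
  have hderiv : ∀ y ∈ Set.Ioo (-ρ) ρ, HasDerivAt (fun z => ∑' n, g n z)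
      (4 / (√(1 - 4 * y) * (1 + √(1 - 4 * y)))) y := by
    intro y hy
    rw [← (hasSum_centralBinom_succ_mul_pow ((abs_lt.2 hy).trans hρ)).tsum_eq]
    exact hasDerivAt_tsum_of_isPreconnected hu isOpen_Ioo isPreconnected_Ioo hg hg' h0 hg0 hy
  have hlog : ∀ y ∈ Set.Ioo (-ρ) ρ, HasDerivAt (fun y => 2 * Real.log (2 / (1 + √(1 - 4 * y))))
      (4 / (√(1 - 4 * y) * (1 + √(1 - 4 * y)))) y := fun y hy =>
    hasDerivAt_two_mul_log_two_div_one_add_sqrt (hy.2.trans hρ)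
  have hmem : r ∈ Set.Ioo (-ρ) ρ := abs_lt.1 hrρ
  have heq : ∑' n, g n r = 2 * Real.log (2 / (1 + √(1 - 4 * r))) :=
    isOpen_Ioo.eqOn_of_deriv_eq isPreconnected_Ioo
      (fun y hy => (hderiv y hy).differentiableAt.differentiableWithinAt)
      (fun y hy => (hlog y hy).differentiableAt.differentiableWithinAt)
      (fun y hy => (hderiv y hy).deriv.trans (hlog y hy).deriv.symm) h0
      (by norm_num [g]) hmem
  rw [← heq]
  exact (summable_of_summable_hasDerivAt_of_isPreconnected hu isOpen_Ioo isPreconnected_Ioo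
    hg hg' h0 hg0 hmem).hasSum

/-- For `0 ≤ r < 1/4`, `Σ_{n≥1} (1/n)·C(2n,n)·rⁿ = 2·log(2/(1 + √(1-4r)))`. -/
theorem stmt_19 (r : ℝ) (hr0 : 0 ≤ r) (hr : r < 1 / 4) :
    HasSum
      (fun n : ℕ => (1 / ((n : ℝ) + 1)) * (Nat.choose (2 * (n + 1)) (n + 1) : ℝ)
        * r ^ (n + 1))
      (2 * Real.log (2 / (1 + Real.sqrt (1 - 4 * r)))) :=
  hasSum_centralBinom_succ_div_mul_pow (by rwa [abs_of_nonneg hr0])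
end
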